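/- Let L be a domain, let E be a topological space, and let ν be an L-valued maxitive measure on the Borel σ-algebra ℬ of E. Then, for every compact Borel set K, ν⁺(K) is the supremum of {ν⁺([x]) : x ∈ K}. Consequently, ν is weakly outer-continuous if and only if ν([x]) = ν⁺([x]) for every x ∈ E. -/

import Mathlib

open Set

universe u v

section OrderDefs
variable {L : Type u} [PartialOrder L]

/-- A filtered (nonempty, downward directed) subset of a poset. -/
def DirFiltered (F : Set L) : Prop :=
  F.Nonempty ∧ ∀ r ∈ F, ∀ s ∈ F, ∃ t ∈ F, t ≤ r ∧ t ≤ s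

/-- A filter of a poset: a filtered upper set. -/
def OrdFilter (F : Set L) : Prop :=
  DirFiltered F ∧ ∀ r ∈ F, ∀ s : L, r ≤ s → s ∈ F

/-- Every filter has an infimum. -/
def FilteredComplete (L : Type u) [PartialOrder L] : Prop :=
  ∀ F : Set L, OrdFilter F → ∃ i : L, IsGLB F i

/-- `s` is way-above `r`: for every filter `F` with an infimum below `r`, `s ∈ F`. -/
def WayAbove (s r : L) : Prop :=
  ∀ F : Set L, OrdFilter F → ∀ i : L, IsGLB F i → i ≤ r → s ∈ F

/-- The poset is continuous: for every `r`, the set of elements way-above `r`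
is a filter whose infimum is `r`. -/
def ContinuousPoset (L : Type u) [PartialOrder L] : Prop :=
  ∀ r : L, OrdFilter {s : L | WayAbove s r} ∧ IsGLB {s : L | WayAbove s r} r

/-- Conditional completeness: every nonempty set bounded above has a supremum. -/
def CondComplete (L : Type u) [PartialOrder L] : Prop :=
  ∀ S : Set L, S.Nonempty → BddAbove S → ∃ m : L, IsLUB S m

end OrderDefs

/-- A domain: a filtered-complete continuous poset with a least element. -/
def DomainPoset (L : Type u) [PartialOrder L] [OrderBot L] : Prop :=
  FilteredComplete L ∧ ContinuousPoset L

section TopDefs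
variable {E : Type v} [TopologicalSpace E]

/-- The saturation of a set: intersection of all open sets containing it. -/
def satur (A : Set E) : Set E := ⋂₀ {G : Set E | IsOpen G ∧ A ⊆ G}

/-- A set is saturated if it is an intersection of open sets. -/
def IsSatur (A : Set E) : Prop :=
  ∃ 𝒢 : Set (Set E), (∀ G ∈ 𝒢, IsOpen G) ∧ A = ⋂₀ 𝒢

/-- The collection 𝒬 of compact saturated subsets. -/
def CompactSat (E : Type v) [TopologicalSpace E] : Set (Set E) :=
  {A : Set E | IsCompact A ∧ IsSatur A}

/-- The Borel σ-algebra generated by open sets and compact saturated sets. -/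
def BorelM (E : Type v) [TopologicalSpace E] : MeasurableSpace E :=
  MeasurableSpace.generateFrom ({A : Set E | IsOpen A} ∪ CompactSat E)

/-- Borel subsets for the σ-algebra generated by opens and compact saturated sets. -/
def IsBorelSet (B : Set E) : Prop := @MeasurableSet E (BorelM E) B

/-- The collection 𝒦 of compact Borel subsets. -/
def CompactBorel (E : Type v) [TopologicalSpace E] : Set (Set E) :=
  {A : Set E | IsBorelSet A ∧ IsCompact A}

/-- `[x]` : the compact Borel set `↑{x} ∩ closure {x}`. -/
def ptClass (x : E) : Set E := satur {x} ∩ closure {x}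

end TopDefs

section MeasDefs
variable {L : Type u} {E : Type v} [PartialOrder L] [OrderBot L] [TopologicalSpace E]

/-- An L-valued maxitive measure on the Borel σ-algebra. -/
def Maxitive (ν : Set E → L) : Prop :=
  ν ∅ = ⊥ ∧ ∀ 𝒞 : Set (Set E), 𝒞.Finite → (∀ B ∈ 𝒞, IsBorelSet B) →
    IsLUB (ν '' 𝒞) (ν (⋃₀ 𝒞))

/-- σ-maxitivity. -/
def SigmaMaxitive (ν : Set E → L) : Prop :=
  Maxitive ν ∧ ∀ 𝒞 : Set (Set E), 𝒞.Countable → (∀ B ∈ 𝒞, IsBorelSet B) →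
    IsLUB (ν '' 𝒞) (ν (⋃₀ 𝒞))

/-- Complete maxitivity. -/
def CompletelyMaxitive (ν : Set E → L) : Prop :=
  Maxitive ν ∧ ∀ 𝒞 : Set (Set E), (∀ B ∈ 𝒞, IsBorelSet B) → IsBorelSet (⋃₀ 𝒞) →
    IsLUB (ν '' 𝒞) (ν (⋃₀ 𝒞))

/-- The set `{ν G : G open, G ⊇ B}`. -/
def outerVals (ν : Set E → L) (B : Set E) : Set L :=
  {l : L | ∃ G : Set E, IsOpen G ∧ B ⊆ G ∧ ν G = l}

/-- `νp` is the map `ν⁺ : B ↦ inf {ν G : G open, G ⊇ B}` on Borel sets. -/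
def IsNuPlus (ν νp : Set E → L) : Prop :=
  ∀ B : Set E, IsBorelSet B → IsGLB (outerVals ν B) (νp B)

/-- Outer-continuity. -/
def OuterContinuous (ν : Set E → L) : Prop :=
  ∀ B : Set E, IsBorelSet B → IsGLB (outerVals ν B) (ν B)

/-- Inner-continuity. -/
def InnerContinuous (ν : Set E → L) : Prop :=
  ∀ B : Set E, IsBorelSet B →
    IsLUB {l : L | ∃ K : Set E, IsBorelSet K ∧ IsCompact K ∧ K ⊆ B ∧ ν (satur K) = l} (ν B)

/-- Regularity: inner- and outer-continuity. -/
def RegularMeasure (ν : Set E → L) : Prop :=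
  InnerContinuous ν ∧ OuterContinuous ν

/-- Weak outer-continuity: `ν K = ν⁺ K` for every compact Borel `K`. -/
def WeaklyOuterContinuous (ν : Set E → L) : Prop :=
  ∀ K : Set E, IsBorelSet K → IsCompact K → IsGLB (outerVals ν K) (ν K)

/-- Weak inner-continuity (relative to a given `ν⁺ = νp`). -/
def WeaklyInnerContinuous (ν νp : Set E → L) : Prop :=
  ∀ G : Set E, IsOpen G →
    IsLUB {l : L | ∃ K : Set E, IsBorelSet K ∧ IsCompact K ∧ K ⊆ G ∧ νp K = l} (ν G)

/-- 𝒜-smoothness. -/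
def SmoothWrt (ν : Set E → L) (𝒜 : Set (Set E)) : Prop :=
  ∀ 𝒟 : Set (Set E), 𝒟.Nonempty → 𝒟 ⊆ 𝒜 → DirectedOn (· ⊇ ·) 𝒟 →
    IsGLB (ν '' 𝒟) (ν (⋂₀ 𝒟))

/-- Saturation of a maxitive measure: `ν K = ν (↑K)` for compact Borel `K`. -/
def SaturatedMeasure (ν : Set E → L) : Prop :=
  ∀ K : Set E, IsBorelSet K → IsCompact K → ν K = ν (satur K)

/-- Tightness: `inf {ν (E ∖ K) : K compact Borel} = 0`. -/
def TightMeasure (ν : Set E → L) : Prop :=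
  IsGLB {l : L | ∃ K : Set E, IsBorelSet K ∧ IsCompact K ∧ ν Kᶜ = l} (⊥ : L)

/-- `c` is a cardinal density of `ν`. -/
def IsCardinalDensity (ν : Set E → L) (c : E → L) : Prop :=
  ∀ B : Set E, IsBorelSet B → IsLUB (c '' B) (ν B)

/-- Upper semicontinuity of a map into the poset. -/
def UscMap (c : E → L) : Prop := ∀ t : L, IsOpen {x : E | WayAbove t (c x)}

/-- Upper compactness of a map into the poset. -/
def UpperCompactMap (c : E → L) : Prop :=
  ∀ t : L, WayAbove t (⊥ : L) → IsCompact {x : E | ¬ WayAbove t (c x)}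

/-- Continuity from above along decreasing sequences of Borel sets. -/
def ContinuousFromAbove (ν : Set E → L) : Prop :=
  ∀ B : ℕ → Set E, (∀ n, IsBorelSet (B n)) → (∀ n, B (n + 1) ⊆ B n) →
    IsGLB (Set.range fun n => ν (B n)) (ν (⋂ n, B n))

/-- An optimal measure: a σ-maxitive measure continuous from above. -/
def OptimalMeasure (ν : Set E → L) : Prop :=
  SigmaMaxitive ν ∧ ContinuousFromAbove ν

/-- `flo` is the regular part `⌊ν⌋` (relative to `νp = ν⁺`):
`⌊ν⌋(B) = sup {ν⁺(K) : K compact Borel, K ⊆ B}`. -/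
def RegPartRel (νp flo : Set E → L) : Prop :=
  ∀ B : Set E, IsBorelSet B →
    IsLUB {l : L | ∃ K : Set E, IsBorelSet K ∧ IsCompact K ∧ K ⊆ B ∧ νp K = l} (flo B)

end MeasDefs

section TopLemmas
variable {E : Type v} [TopologicalSpace E]

theorem IsOpen.isBorelSet {G : Set E} (hG : IsOpen G) : IsBorelSet G :=
  MeasurableSpace.measurableSet_generateFrom (Or.inl hG)

theorem mem_satur_singleton {x y : E} :
    y ∈ satur {x} ↔ ∀ G : Set E, IsOpen G → x ∈ G → y ∈ G := by
  simp [satur]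

theorem satur_singleton_subset {x : E} {G : Set E} (hG : IsOpen G) (hx : x ∈ G) :
    satur {x} ⊆ G :=
  fun _ hy => mem_satur_singleton.1 hy G hG hx

theorem self_mem_satur (x : E) : x ∈ satur {x} :=
  mem_satur_singleton.2 fun _ _ h => h

theorem self_mem_ptClass (x : E) : x ∈ ptClass x :=
  ⟨self_mem_satur x, subset_closure rfl⟩

theorem ptClass_subset {x : E} {G : Set E} (hG : IsOpen G) (hx : x ∈ G) : ptClass x ⊆ G :=
  inter_subset_left.trans (satur_singleton_subset hG hx)

theorem isCompact_satur_singleton (x : E) : IsCompact (satur {x}) := by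
  refine isCompact_of_finite_subcover fun {ι} U hU hcov => ?_
  obtain ⟨i, hi⟩ := mem_iUnion.1 (hcov (self_mem_satur x))
  exact ⟨{i}, by simpa using satur_singleton_subset (hU i) hi⟩

theorem isBorelSet_ptClass (x : E) : IsBorelSet (ptClass x) := by
  refine @MeasurableSet.inter E (BorelM E) _ _ ?_ ?_
  · exact MeasurableSpace.measurableSet_generateFrom
      (Or.inr ⟨isCompact_satur_singleton x, _, fun _ h => h.1, rfl⟩)
  · exact (@MeasurableSet.compl_iff E _ (BorelM E)).1
      (isClosed_closure (s := {x})).isOpen_compl.isBorelSet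

theorem isCompact_ptClass (x : E) : IsCompact (ptClass x) :=
  (isCompact_satur_singleton x).inter_right isClosed_closure

theorem inseparable_of_mem_ptClass {x y : E} (h : y ∈ ptClass x) : Inseparable y x := by
  refine inseparable_iff_forall_isOpen.2 fun G hG => ⟨fun hy => ?_, mem_satur_singleton.1 h.1 G hG⟩
  obtain ⟨z, hz, rfl⟩ := mem_closure_iff.1 h.2 G hG hy
  exact hz

theorem IsBorelSet.mem_iff_of_inseparable {B : Set E} (hB : IsBorelSet B) {x y : E}
    (h : Inseparable x y) : x ∈ B ↔ y ∈ B := by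
  have hop := inseparable_iff_forall_isOpen.1 h
  induction B, hB using MeasurableSpace.generateFrom_induction with
  | hC t ht _ =>
    rcases ht with ht | ⟨-, 𝒢, h𝒢, rfl⟩
    · exact hop t ht
    · exact forall₂_congr fun G hG => hop G (h𝒢 G hG)
  | empty => simp
  | compl t _ ih => exact not_congr ih
  | iUnion f _ ih => simp only [mem_iUnion, ih]

theorem IsBorelSet.ptClass_subset {B : Set E} (hB : IsBorelSet B) {x : E} (hx : x ∈ B) :
    ptClass x ⊆ B :=
  fun _ hy => (hB.mem_iff_of_inseparable (inseparable_of_mem_ptClass hy)).2 hx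

end TopLemmas

section OrderLemmas
variable {L : Type u} [PartialOrder L]

/-- A way-above element dominates a member of any filtered set with infimum below. -/
theorem WayAbove.exists_mem_le {F : Set L} {s r i : L} (hs : WayAbove s r)
    (hF : DirFiltered F) (hi : IsGLB F i) (hir : i ≤ r) : ∃ t ∈ F, t ≤ s := by
  obtain ⟨⟨a, ha⟩, hdir⟩ := hF
  refine hs {l | ∃ t ∈ F, t ≤ l} ⟨⟨⟨a, a, ha, le_rfl⟩, ?_⟩, ?_⟩ i ⟨?_, ?_⟩ hir
  · rintro b ⟨t, ht, htb⟩ c ⟨t', ht', htc⟩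
    obtain ⟨w, hw, hwt, hwt'⟩ := hdir t ht t' ht'
    exact ⟨w, ⟨w, hw, le_rfl⟩, hwt.trans htb, hwt'.trans htc⟩
  · rintro b ⟨t, ht, htb⟩ c hbc
    exact ⟨t, ht, htb.trans hbc⟩
  · rintro b ⟨t, ht, htb⟩
    exact (hi.1 ht).trans htb
  · exact fun b hb => hi.2 fun t ht => hb ⟨t, ht, le_rfl⟩

end OrderLemmas

section MeasLemmas
variable {L : Type u} {E : Type v} [PartialOrder L] [OrderBot L] [TopologicalSpace E]
  {ν νp : Set E → L}

theorem Maxitive.mono (hν : Maxitive ν) {A B : Set E} (hA : IsBorelSet A) (hB : IsBorelSet B)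
    (hAB : A ⊆ B) : ν A ≤ ν B := by
  have h := hν.2 {A, B} (by simp) (by simp [hA, hB])
  rw [sUnion_pair, union_eq_self_of_subset_left hAB] at h
  exact h.1 ⟨A, by simp, rfl⟩

theorem Maxitive.dirFiltered_outerVals (hν : Maxitive ν) (B : Set E) :
    DirFiltered (outerVals ν B) := by
  refine ⟨⟨ν univ, univ, isOpen_univ, subset_univ B, rfl⟩, ?_⟩
  rintro _ ⟨G, hG, hBG, rfl⟩ _ ⟨H, hH, hBH, rfl⟩
  exact ⟨_, ⟨G ∩ H, hG.inter hH, subset_inter hBG hBH, rfl⟩,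
    hν.mono (hG.inter hH).isBorelSet hG.isBorelSet inter_subset_left,
    hν.mono (hG.inter hH).isBorelSet hH.isBorelSet inter_subset_right⟩

/-- On compact Borel sets, `ν⁺` is the supremum of its values on point classes. -/
theorem IsNuPlus.isLUB_ptClass (hL : ContinuousPoset L) (hν : Maxitive ν) (hνp : IsNuPlus ν νp)
    {K : Set E} (hK : IsBorelSet K) (hKc : IsCompact K) :
    IsLUB ((fun x : E => νp (ptClass x)) '' K) (νp K) := by
  constructor
  · rintro _ ⟨x, hx, rfl⟩
    refine (hνp K hK).2 ?_
    rintro _ ⟨G, hG, hKG, rfl⟩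
    exact (hνp _ (isBorelSet_ptClass x)).1 ⟨G, hG, ptClass_subset hG (hKG hx), rfl⟩
  · intro u hu
    refine (hL u).2.2 fun s hs => ?_
    have hcov : ∀ x ∈ K, ∃ G : Set E, IsOpen G ∧ x ∈ G ∧ ν G ≤ s := by
      intro x hx
      obtain ⟨_, ⟨G, hG, hxG, rfl⟩, hGs⟩ := hs.exists_mem_le
        (hν.dirFiltered_outerVals (ptClass x)) (hνp _ (isBorelSet_ptClass x))
        (hu ⟨x, hx, rfl⟩)
      exact ⟨G, hG, hxG (self_mem_ptClass x), hGs⟩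
    obtain ⟨T, hT, hTfin, hKT⟩ := hKc.elim_finite_subcover_image
      (b := {G : Set E | IsOpen G ∧ ν G ≤ s}) (c := id) (fun _ h => h.1) fun x hx => by
        obtain ⟨G, hG, hxG, hGs⟩ := hcov x hx
        exact mem_biUnion (show G ∈ {G : Set E | IsOpen G ∧ ν G ≤ s} from ⟨hG, hGs⟩) hxG
    replace hKT : K ⊆ ⋃₀ T := by rwa [sUnion_eq_biUnion]
    refine ((hνp K hK).1 ⟨_, isOpen_sUnion fun G hG => (hT hG).1, hKT, rfl⟩).trans
      ((hν.2 T hTfin fun G hG => (hT hG).1.isBorelSet).2 ?_)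
    rintro _ ⟨G, hG, rfl⟩
    exact (hT hG).2

end MeasLemmas

/-- for every compact Borel K, `ν⁺(K) = sup {ν⁺([x]) : x ∈ K}`;
consequently ν is weakly outer-continuous iff `ν([x]) = ν⁺([x])` for all x. -/
theorem stmt16 {L : Type u} {E : Type v} [PartialOrder L] [OrderBot L]
    [TopologicalSpace E] (hL : DomainPoset L)
    (ν νp : Set E → L) (hν : Maxitive ν) (hνp : IsNuPlus ν νp) :
    (∀ K : Set E, IsBorelSet K → IsCompact K →
      IsLUB ((fun x : E => νp (ptClass x)) '' K) (νp K)) ∧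
    (WeaklyOuterContinuous ν ↔ ∀ x : E, ν (ptClass x) = νp (ptClass x)) := by
  have hsup : ∀ K : Set E, IsBorelSet K → IsCompact K →
      IsLUB ((fun x : E => νp (ptClass x)) '' K) (νp K) :=
    fun K hK hKc => hνp.isLUB_ptClass hL.2 hν hK hKc
  refine ⟨hsup, fun h x => ?_, fun h K hK hKc => ⟨?_, fun b hb => ?_⟩⟩
  · exact (h _ (isBorelSet_ptClass x) (isCompact_ptClass x)).unique
      (hνp _ (isBorelSet_ptClass x))
  · rintro _ ⟨G, hG, hKG, rfl⟩
    exact hν.mono hK hG.isBorelSet hKG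
  · refine ((hνp K hK).2 hb).trans ((hsup K hK hKc).2 ?_)
    rintro _ ⟨x, hx, rfl⟩
    exact (h x).symm.trans_le (hν.mono (isBorelSet_ptClass x) hK (hK.ptClass_subset hx))
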